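/- Let p ≥ 1 be an integer, ε > 0, L ≥ 0, θ ≥ 1, and 0 < σ ≤ σ_max. Suppose s, g⁺, g_T ∈ ℝ^n satisfy ‖g⁺‖_{N,1} > ε, ‖g⁺ − g_T‖_{N,1} ≤ (L/p!) N(s)^p, and ‖g_T‖_{N,1} ≤ θ (σ/p!) N(s)^p. Then N(s)^p ≥ p! · ε / (L + θ σ_max). -/

import Mathlib

open scoped RealInnerProductSpace

noncomputable section

/-- Abbreviation for the Euclidean space `ℝ^n`. -/
abbrev E (n : ℕ) := EuclideanSpace ℝ (Fin n)

/-- `N` is a norm on `ℝ^n` (possibly non-smooth, e.g. `ℓ¹` or `ℓ∞`). -/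
structure IsNorm (n : ℕ) (N : E n → ℝ) : Prop where
  add_le : ∀ x y, N (x + y) ≤ N x + N y
  smul : ∀ (c : ℝ) (x : E n), N (c • x) = |c| * N x
  eq_zero : ∀ x, N x = 0 → x = 0

/-- The dual norm `‖v‖_{N,1} := max_{N s = 1} ⟪v, s⟫`. -/
def dualNorm (n : ℕ) (N : E n → ℝ) (v : E n) : ℝ :=
  sSup {t : ℝ | ∃ s, N s = 1 ∧ t = ⟪v, s⟫}

namespace IsNorm

variable {n : ℕ} {N : E n → ℝ}

theorem map_zero (hN : IsNorm n N) : N 0 = 0 := by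
  simpa using hN.smul 0 0

theorem nonneg (hN : IsNorm n N) (x : E n) : 0 ≤ N x := by
  have h := hN.add_le x ((-1 : ℝ) • x)
  rw [hN.smul, neg_one_smul, add_neg_cancel, hN.map_zero] at h
  norm_num at h
  linarith

theorem convexOn (hN : IsNorm n N) : ConvexOn ℝ Set.univ N := by
  refine ⟨convex_univ, fun x _ y _ a b ha hb _ => ?_⟩
  simpa [hN.smul, abs_of_nonneg ha, abs_of_nonneg hb] using hN.add_le (a • x) (b • y)

theorem continuous (hN : IsNorm n N) : Continuous N :=
  continuousOn_univ.mp (hN.convexOn.continuousOn isOpen_univ)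

/-- Every norm on `ℝ^n` dominates a positive multiple of the Euclidean norm. -/
theorem exists_pos_mul_norm_le (hN : IsNorm n N) : ∃ c > 0, ∀ x, c * ‖x‖ ≤ N x := by
  rcases (Metric.sphere (0 : E n) 1).eq_empty_or_nonempty with h | h
  · refine ⟨1, one_pos, fun x => ?_⟩
    by_cases hx : x = 0
    · simp [hx, hN.map_zero]
    · have hm : ‖x‖⁻¹ • x ∈ Metric.sphere (0 : E n) 1 := by
        simp [norm_smul, hx]
      simp [h] at hm
  · obtain ⟨u, hu, hmin⟩ := (isCompact_sphere (0 : E n) 1).exists_isMinOn h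
      hN.continuous.continuousOn
    have hu0 : u ≠ 0 := ne_zero_of_mem_unit_sphere ⟨u, hu⟩
    refine ⟨N u, (hN.nonneg u).lt_of_ne fun h0 => hu0 (hN.eq_zero u h0.symm), fun x => ?_⟩
    by_cases hx : x = 0
    · simp [hx, hN.map_zero]
    · have hm : ‖x‖⁻¹ • x ∈ Metric.sphere (0 : E n) 1 := by
        simp [norm_smul, hx]
      have hle : N u ≤ N (‖x‖⁻¹ • x) := hmin hm
      rw [hN.smul, abs_of_nonneg (by positivity), inv_mul_eq_div] at hle
      exact (le_div_iff₀ (norm_pos_iff.mpr hx)).mp hle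

theorem bddAbove_inner (hN : IsNorm n N) (v : E n) :
    BddAbove {t : ℝ | ∃ s, N s = 1 ∧ t = ⟪v, s⟫} := by
  obtain ⟨c, hc, h⟩ := hN.exists_pos_mul_norm_le
  refine ⟨‖v‖ * (1 / c), ?_⟩
  rintro _ ⟨s, hs, rfl⟩
  refine (real_inner_le_norm v s).trans (mul_le_mul_of_nonneg_left ?_ (norm_nonneg v))
  rw [le_div_iff₀ hc, mul_comm, ← hs]
  exact h s

theorem inner_le_dualNorm (hN : IsNorm n N) (v : E n) {s : E n} (hs : N s = 1) :
    ⟪v, s⟫ ≤ dualNorm n N v :=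
  le_csSup (hN.bddAbove_inner v) ⟨s, hs, rfl⟩

theorem dualNorm_add_le (hN : IsNorm n N) (v w : E n) :
    dualNorm n N (v + w) ≤ dualNorm n N v + dualNorm n N w := by
  by_cases hne : ∃ s, N s = 1
  · obtain ⟨s₀, hs₀⟩ := hne
    refine csSup_le ⟨_, s₀, hs₀, rfl⟩ ?_
    rintro _ ⟨s, hs, rfl⟩
    rw [inner_add_left]
    exact add_le_add (hN.inner_le_dualNorm v hs) (hN.inner_le_dualNorm w hs)
  · push Not at hne
    simp [dualNorm, hne]

end IsNorm

/-- lower bound on the step norm: if `‖g⁺‖_{N,1} > ε`,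
`‖g⁺ − g_T‖_{N,1} ≤ (L/p!) N(s)^p` and `‖g_T‖_{N,1} ≤ θ (σ/p!) N(s)^p` with
`0 < σ ≤ σmax`, then `N(s)^p ≥ p! ε/(L + θ σmax)`. -/
theorem stmt7 {n : ℕ} (hn : 1 ≤ n) (N : E n → ℝ) (hN : IsNorm n N)
    (p : ℕ) (hp : 1 ≤ p) (ε L θ σ σmax : ℝ)
    (hε : 0 < ε) (hL : 0 ≤ L) (hθ : 1 ≤ θ) (hσ : 0 < σ) (hσmax : σ ≤ σmax)
    (s gplus gT : E n)
    (h1 : ε < dualNorm n N gplus)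
    (h2 : dualNorm n N (gplus - gT) ≤ L / (p.factorial : ℝ) * N s ^ p)
    (h3 : dualNorm n N gT ≤ θ * (σ / (p.factorial : ℝ)) * N s ^ p) :
    N s ^ p ≥ (p.factorial : ℝ) * ε / (L + θ * σmax) := by
  have hadd := hN.dualNorm_add_le (gplus - gT) gT
  rw [sub_add_cancel] at hadd
  have hf : (0 : ℝ) < p.factorial := by positivity
  have hpow : 0 ≤ N s ^ p := pow_nonneg (hN.nonneg s) p
  have hθσ : θ * σ ≤ θ * σmax := mul_le_mul_of_nonneg_left hσmax (by linarith)
  have hpos : 0 < L + θ * σmax := by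
    have : 0 < θ * σ := mul_pos (by linarith) hσ
    linarith
  have key : ε ≤ (L + θ * σ) * N s ^ p / p.factorial := by
    calc ε ≤ L / p.factorial * N s ^ p + θ * (σ / p.factorial) * N s ^ p := by linarith
      _ = (L + θ * σ) * N s ^ p / p.factorial := by ring
  rw [le_div_iff₀ hf] at key
  rw [ge_iff_le, div_le_iff₀ hpos]
  have := mul_le_mul_of_nonneg_right hθσ hpow
  linarith
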